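/- Let φ be a self-excitation d-kernel and μ measurable baselines. For every T ≥ 0, every n ≥ 1, and every tuple of points x₁,…,xₙ with 0 < t₁ < ⋯ < tₙ ≤ T, the intensity functional ϖ ↦ λ^i_T(ϖ) satisfies 𝒯ⁿ_{(x₁,…,xₙ)} λ^i_T = φ^{i,kₙ}(T − tₙ, yₙ) · 𝒯^{n−1}_{(x₁,…,x_{n−1})} G, where G(ϖ) := 1_{θₙ ≤ λ^{kₙ}_{tₙ}(ϖ)}, for every i ∈ {1,…,d}. -/

import Mathlib

open MeasureTheory Finset Filter

noncomputable section
namespace MSPD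

/-- A marked point `(k, t, θ, y)` of `{1,…,d} × ℝ₊³`. -/
abbrev Point (d : ℕ) := Fin d × ℝ × ℝ × ℝ

variable {d : ℕ}

/-- Auxiliary intensity functional, with fuel `n`. -/
def lamAux (φ : Fin d → Fin d → ℝ → ℝ → ℝ) (μ : Fin d → ℝ → ℝ) :
    ℕ → Finset (Point d) → Fin d → ℝ → ℝ
  | 0, _, i, t => μ i t
  | n + 1, ϖ, i, t => μ i t + ∑ x ∈ ϖ.filter (fun x => x.2.1 < t),
      φ i x.1 (t - x.2.1) x.2.2.2 * (if x.2.2.1 ≤ lamAux φ μ n ϖ x.1 x.2.1 then 1 else 0)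

/-- The intensity functional `λ^i_t(ϖ)`, defined by recursion on the time order of
the points of the finite configuration `ϖ`. -/
def lam (φ : Fin d → Fin d → ℝ → ℝ → ℝ) (μ : Fin d → ℝ → ℝ)
    (ϖ : Finset (Point d)) (i : Fin d) (t : ℝ) : ℝ :=
  lamAux φ μ ϖ.card ϖ i t

/-- The MSPD functional `Z^i_T(ϖ)`. -/
def Zfun (ζ φ : Fin d → Fin d → ℝ → ℝ → ℝ) (μ : Fin d → ℝ → ℝ)
    (T : ℝ) (i : Fin d) (ϖ : Finset (Point d)) : ℝ :=
  ∑ x ∈ ϖ.filter (fun x => x.2.1 ≤ T),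
    ζ i x.1 (T - x.2.1) x.2.2.2 * (if x.2.2.1 ≤ lam φ μ ϖ x.1 x.2.1 then 1 else 0)

/-- The iterated difference operator `𝒯ⁿ_{(x₁,…,xₙ)} F`. -/
def Tdiff (n : ℕ) (xs : Fin n → Point d) (F : Finset (Point d) → ℝ) : ℝ :=
  ∑ J : Finset (Fin n), (-1 : ℝ) ^ (n - J.card) * F (J.image xs)

/-- `ζ` is a d-kernel with respect to the family of mark laws `ν`. -/
def IsKernel (ν : Fin d → Measure ℝ) (ζ : Fin d → Fin d → ℝ → ℝ → ℝ) : Prop :=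
  (∀ i k, Measurable fun p : ℝ × ℝ => ζ i k p.1 p.2) ∧
    (∀ i k t y, 0 ≤ ζ i k t y) ∧ ∀ i k t, Integrable (fun y => ζ i k t y) (ν k)

/-- `φ` is a self-excitation d-kernel: a d-kernel vanishing for nonpositive times. -/
def IsSelfExciting (ν : Fin d → Measure ℝ) (φ : Fin d → Fin d → ℝ → ℝ → ℝ) : Prop :=
  IsKernel ν φ ∧ ∀ i k τ y, τ ≤ 0 → φ i k τ y = 0

/-- `μ` is a family of measurable nonnegative baselines. -/
def IsBaseline (μ : Fin d → ℝ → ℝ) : Prop :=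
  (∀ i, Measurable (μ i)) ∧ ∀ i t, 0 ≤ μ i t

/-- The compatibility condition for a time-ordered tuple of points. -/
def Compatible (φ : Fin d → Fin d → ℝ → ℝ → ℝ) (μ : Fin d → ℝ → ℝ)
    {n : ℕ} (xs : Fin n → Point d) : Prop :=
  ∀ m : Fin n, (xs m).2.2.1 ≤ μ (xs m).1 (xs m).2.1 +
    ∑ j ∈ Finset.Iio m, φ (xs m).1 (xs j).1 ((xs m).2.1 - (xs j).2.1) (xs j).2.2.2

end MSPD
end

open MSPD MeasureTheory

namespace MSPD

variable {d : ℕ} {φ : Fin d → Fin d → ℝ → ℝ → ℝ} {μ : Fin d → ℝ → ℝ}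

/-- With enough fuel, `lamAux` at time `t` depends only on the points strictly before `t`. -/
lemma lamAux_congr {ϖ ϖ' : Finset (Point d)} (n m : ℕ) (i : Fin d) (t : ℝ)
    (h : ϖ.filter (fun x => x.2.1 < t) = ϖ'.filter (fun x => x.2.1 < t))
    (hn : (ϖ.filter (fun x => x.2.1 < t)).card ≤ n)
    (hm : (ϖ.filter (fun x => x.2.1 < t)).card ≤ m) :
    lamAux φ μ n ϖ i t = lamAux φ μ m ϖ' i t := by
  induction n generalizing m i t with
  | zero =>
    have he : ϖ.filter (fun x => x.2.1 < t) = ∅ := by simpa using hn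
    cases m with
    | zero => rfl
    | succ m => simp only [lamAux, ← h, he, Finset.sum_empty, add_zero]
  | succ n ih =>
    cases m with
    | zero =>
      have he : ϖ.filter (fun x => x.2.1 < t) = ∅ := by simpa using hm
      simp only [lamAux, he, Finset.sum_empty, add_zero]
    | succ m =>
      simp only [lamAux, ← h]
      congr 1
      refine Finset.sum_congr rfl fun x hx => ?_
      obtain ⟨hxϖ, hxt⟩ := Finset.mem_filter.mp hx
      have hlt : (ϖ.filter (fun z => z.2.1 < x.2.1)).card <
          (ϖ.filter (fun z => z.2.1 < t)).card := by
        refine Finset.card_lt_card (Finset.ssubset_iff_of_subset ?_ |>.mpr ⟨x, hx, by simp⟩)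
        exact Finset.monotone_filter_right _ fun z _ hz => lt_trans hz hxt
      rw [ih m x.1 x.2.1 ?_ (by omega) (by omega)]
      ext z
      have hz := Finset.ext_iff.mp h z
      simp only [Finset.mem_filter] at hz ⊢
      constructor
      · rintro ⟨h1, h2⟩
        exact ⟨(hz.mp ⟨h1, h2.trans hxt⟩).1, h2⟩
      · rintro ⟨h1, h2⟩
        exact ⟨(hz.mpr ⟨h1, h2.trans hxt⟩).1, h2⟩

/-- The intensity at time `t` depends only on the points strictly before `t`. -/
lemma lam_congr {ϖ ϖ' : Finset (Point d)} (i : Fin d) (t : ℝ)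
    (h : ϖ.filter (fun x => x.2.1 < t) = ϖ'.filter (fun x => x.2.1 < t)) :
    lam φ μ ϖ i t = lam φ μ ϖ' i t :=
  lamAux_congr _ _ i t h (Finset.card_filter_le _ _) (h ▸ Finset.card_filter_le _ _)

/-- The recursion defining the intensity functional. -/
lemma lam_eq (ϖ : Finset (Point d)) (i : Fin d) (t : ℝ) :
    lam φ μ ϖ i t = μ i t + ∑ x ∈ ϖ.filter (fun x => x.2.1 < t),
      φ i x.1 (t - x.2.1) x.2.2.2 * (if x.2.2.1 ≤ lam φ μ ϖ x.1 x.2.1 then 1 else 0) :=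
  lamAux_congr ϖ.card (ϖ.card + 1) i t rfl (Finset.card_filter_le _ _)
    ((Finset.card_filter_le _ _).trans (Nat.le_succ _))

/-- Adding a point does not change the intensity up to the time of that point. -/
lemma lam_insert_of_le (x : Point d) (ϖ : Finset (Point d)) (i : Fin d) {t : ℝ}
    (ht : t ≤ x.2.1) : lam φ μ (insert x ϖ) i t = lam φ μ ϖ i t :=
  lam_congr i t (by rw [Finset.filter_insert, if_neg ht.not_gt])

/-- The effect on the intensity of adding a point later than all the others. -/
lemma lam_insert (hφ : ∀ i k τ y, τ ≤ 0 → φ i k τ y = 0) (x : Point d)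
    (ϖ : Finset (Point d)) (hx : ∀ z ∈ ϖ, z.2.1 < x.2.1) (i : Fin d) (t : ℝ) :
    lam φ μ (insert x ϖ) i t = lam φ μ ϖ i t + φ i x.1 (t - x.2.1) x.2.2.2 *
      (if x.2.2.1 ≤ lam φ μ ϖ x.1 x.2.1 then 1 else 0) := by
  rcases le_or_gt t x.2.1 with ht | ht
  · rw [lam_insert_of_le x ϖ i ht, hφ i x.1 _ _ (sub_nonpos.mpr ht), zero_mul, add_zero]
  · have hxϖ : x ∉ ϖ.filter (fun z => z.2.1 < t) := fun h =>
      lt_irrefl _ (hx x (Finset.mem_filter.mp h).1)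
    rw [lam_eq (insert x ϖ), lam_eq ϖ i t, Finset.filter_insert, if_pos ht,
      Finset.sum_insert hxϖ, lam_insert_of_le x ϖ x.1 le_rfl, add_assoc, add_comm (∑ _ ∈ _, _)]
    congr 2
    refine Finset.sum_congr rfl fun z hz => ?_
    rw [lam_insert_of_le x ϖ z.1 (hx z (Finset.mem_filter.mp hz).1).le]

/-- The iterated difference operator, split according to the last point. -/
lemma Tdiff_succ (n : ℕ) (xs : Fin (n + 1) → Point d) (F : Finset (Point d) → ℝ) :
    Tdiff (n + 1) xs F = Tdiff n (fun j => xs j.castSucc)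
      (fun ϖ => F (insert (xs (Fin.last n)) ϖ) - F ϖ) := by
  unfold Tdiff
  have hlast : Fin.last n ∉ (Finset.univ : Finset (Fin n)).image Fin.castSucc := by
    simp
  have huniv : (Finset.univ : Finset (Fin (n + 1))) =
      insert (Fin.last n) (Finset.univ.image Fin.castSucc) := by
    ext j
    refine Fin.lastCases ?_ (fun j => ?_) j <;> simp
  rw [← Finset.powerset_univ, huniv, Finset.sum_powerset_insert hlast, Finset.powerset_image,
    Finset.sum_image (Finset.image_injective (Fin.castSucc_injective n)).injOn,
    Finset.sum_image (Finset.image_injective (Fin.castSucc_injective n)).injOn,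
    Finset.powerset_univ, ← Finset.sum_add_distrib]
  refine Finset.sum_congr rfl fun J _ => ?_
  have hJ : J.card ≤ n := by simpa using Finset.card_le_univ J
  have hnot : Fin.last n ∉ J.image Fin.castSucc := by simp
  have himage : (J.image Fin.castSucc).image xs = J.image fun j => xs j.castSucc :=
    Finset.image_image
  rw [Finset.card_insert_of_notMem hnot,
    Finset.card_image_of_injective _ (Fin.castSucc_injective n), Finset.image_insert, himage,
    Nat.add_sub_add_right, Nat.sub_add_comm hJ, pow_succ]
  ring

end MSPD

/-- the analogous recursion for the intensity functional:
`𝒯^{n+1}_{(x₀,…,xₙ)} λ^i_T = φ^{i,kₙ}(T−tₙ,yₙ) · 𝒯ⁿ_{(x₀,…,x_{n−1})} 1_{θₙ ≤ λ^{kₙ}_{tₙ}}`. -/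
theorem statement1 (d : ℕ) (hd : 1 ≤ d)
    (ν : Fin d → Measure ℝ) [∀ k, IsProbabilityMeasure (ν k)]
    (hν : ∀ k, ν k (Set.Iio 0) = 0)
    (φ : Fin d → Fin d → ℝ → ℝ → ℝ) (μ : Fin d → ℝ → ℝ)
    (hφ : IsSelfExciting ν φ) (hμ : IsBaseline μ)
    (T : ℝ) (hT : 0 ≤ T) (n : ℕ) (xs : Fin (n + 1) → Point d)
    (hmono : StrictMono fun j => (xs j).2.1)
    (h0 : 0 < (xs 0).2.1) (hlast : (xs (Fin.last n)).2.1 ≤ T)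
    (hθ : ∀ j, 0 ≤ (xs j).2.2.1) (hy : ∀ j, 0 ≤ (xs j).2.2.2)
    (i : Fin d) :
    Tdiff (n + 1) xs (fun ϖ => lam φ μ ϖ i T) =
      φ i (xs (Fin.last n)).1 (T - (xs (Fin.last n)).2.1) (xs (Fin.last n)).2.2.2 *
        Tdiff n (fun j => xs j.castSucc)
          (fun ϖ => if (xs (Fin.last n)).2.2.1 ≤
              lam φ μ ϖ (xs (Fin.last n)).1 (xs (Fin.last n)).2.1 then 1 else 0) := by
  rw [Tdiff_succ]
  unfold Tdiff
  rw [Finset.mul_sum]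
  refine Finset.sum_congr rfl fun J _ => ?_
  beta_reduce
  rw [lam_insert hφ.2, add_sub_cancel_left]
  · ring
  · intro z hz
    obtain ⟨j, -, rfl⟩ := Finset.mem_image.mp hz
    exact hmono (Fin.castSucc_lt_last j)
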